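/- Assume Martin's Axiom together with the negation of the Continuum Hypothesis (ω₁ < 𝔠). Then every separable hereditarily supercompact (Hausdorff) space is hereditarily separable and hereditarily Lindelöf. -/

import Mathlib

open Set Topology TopologicalSpace

universe u

/-- A topological space is *supercompact* if it has a subbase `S` for its topology such that
every cover of the space by members of `S` has a subcover with at most two members. -/
def IsSupercompact (X : Type*) [t : TopologicalSpace X] : Prop :=
  ∃ S : Set (Set X), TopologicalSpace.generateFrom S = t ∧
    ∀ C ⊆ S, ⋃₀ C = univ → ∃ T ⊆ C, T.Finite ∧ T.ncard ≤ 2 ∧ ⋃₀ T = univ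

/-- A topological space is *hereditarily supercompact* if each of its closed subspaces is
supercompact. -/
def IsHereditarilySupercompact (X : Type*) [TopologicalSpace X] : Prop :=
  ∀ Z : Set X, IsClosed Z → IsSupercompact Z

/-- Martin's Axiom: for every nonempty ccc partial order `P` (every antichain is countable)
and every family `𝒟` of fewer than `𝔠` dense subsets of `P` there is a filter on `P`
meeting every member of `𝒟`. -/
def MartinsAxiom : Prop :=
  ∀ (P : Type) (_ : PartialOrder P), Nonempty P →
    (∀ A : Set P, (∀ p ∈ A, ∀ q ∈ A, p ≠ q → ¬ ∃ r, r ≤ p ∧ r ≤ q) → A.Countable) →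
    ∀ 𝒟 : Set (Set P), Cardinal.mk 𝒟 < Cardinal.continuum →
      (∀ D ∈ 𝒟, ∀ p : P, ∃ q ∈ D, q ≤ p) →
      ∃ G : Set P, G.Nonempty ∧
        (∀ p ∈ G, ∀ q : P, p ≤ q → q ∈ G) ∧
        (∀ p ∈ G, ∀ q ∈ G, ∃ r ∈ G, r ≤ p ∧ r ≤ q) ∧
        (∀ D ∈ 𝒟, (G ∩ D).Nonempty)

theorem mem_closure_of_mapClusterPt {ι Z : Type*} [TopologicalSpace Z] {l : Filter ι} {f : ι → Z}
    {y : Z} {S : Set Z} (hy : MapClusterPt y l f) (hS : ∀ᶠ n in l, f n ∈ S) : y ∈ closure S :=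
  mem_closure_iff_clusterPt.2 (ClusterPt.mono hy (Filter.le_principal_iff.2 hS))

/-- Countable tightness: a set containing the closures of its countable subsets is closed. -/
def IsCountablyTight (Z : Type*) [TopologicalSpace Z] : Prop :=
  ∀ A : Set Z, (∀ C ⊆ A, C.Countable → closure C ⊆ A) → IsClosed A

theorem IsCountablyTight.exists_countable_mem_closure {Z : Type*} [TopologicalSpace Z]
    (hZ : IsCountablyTight Z) {S : Set Z} {y : Z} (hy : y ∈ closure S) :
    ∃ C ⊆ S, C.Countable ∧ y ∈ closure C := by
  let A : Set Z := {z | ∃ C ⊆ S, C.Countable ∧ z ∈ closure C}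
  have hA : IsClosed A := by
    refine hZ A fun D hDA hD z hz => ?_
    have hDA' : ∀ d ∈ D, ∃ C ⊆ S, C.Countable ∧ d ∈ closure C := fun d hd => hDA hd
    choose! f hfS hfc hf using hDA'
    refine ⟨⋃ d ∈ D, f d, iUnion₂_subset hfS, hD.biUnion hfc, ?_⟩
    refine closure_minimal (fun d hd => ?_) isClosed_closure hz
    exact closure_mono (subset_biUnion_of_mem hd) (hf d hd)
  have hSA : S ⊆ A := fun s hs =>
    ⟨{s}, by simpa using hs, countable_singleton s, subset_closure rfl⟩
  exact closure_minimal hSA hA hy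

theorem IsCountablyTight.of_continuous_surjective {Z W : Type*} [TopologicalSpace Z]
    [CompactSpace Z] [TopologicalSpace W] [T2Space W] (hZ : IsCountablyTight Z) {f : Z → W}
    (hf : Continuous f) (hs : Function.Surjective f) : IsCountablyTight W := by
  intro A hA
  rw [← image_preimage_eq A hs]
  refine hf.isClosedMap _ (hZ _ fun C hC hCc => ?_)
  rw [← image_subset_iff]
  exact (image_closure_subset_closure_image hf).trans
    (hA _ (image_subset_iff.2 hC) (hCc.image f))

theorem IsCountablyTight.prod {Z W : Type*} [TopologicalSpace Z] [TopologicalSpace W]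
    [CompactSpace Z] [T2Space Z] [CompactSpace W] [T2Space W]
    (hZ : IsCountablyTight Z) (hW : IsCountablyTight W) : IsCountablyTight (Z × W) := by
  have key : ∀ A : Set (Z × W), (∀ C ⊆ A, C.Countable → closure C ⊆ A) →
      IsClosed (Prod.fst '' A) := by
    intro A hA
    refine hZ _ fun C hC hCc => ?_
    obtain ⟨B, hBA, hB⟩ := subset_image_iff.1 hC
    have hBc : ∃ B' ⊆ B, B'.Countable ∧ Prod.fst '' B' = C := by
      obtain ⟨B', hB', h⟩ := exists_subset_bijOn B Prod.fst
      exact ⟨B', hB', countable_of_injective_of_countable_image h.injOn (by rwa [h.image_eq, hB]),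
        h.image_eq.trans hB⟩
    obtain ⟨B', hB', hB'c, h1⟩ := hBc
    have h2 : closure C ⊆ Prod.fst '' closure B' := by
      refine closure_minimal ?_ (continuous_fst.isClosedMap _ isClosed_closure)
      conv_lhs => rw [← h1]
      exact image_mono subset_closure
    exact h2.trans (image_mono (hA _ (hB'.trans hBA) hB'c))
  intro A hA
  refine isClosed_of_closure_subset fun p hp => ?_
  by_contra hpA
  have hfib : IsClosed {w : W | (p.1, w) ∈ A} := by
    refine hW _ fun C hC hCc w hw => ?_
    have hc : Continuous fun w : W => (p.1, w) := by fun_prop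
    exact hA _ (image_subset_iff.2 hC) (hCc.image _)
      (image_closure_subset_closure_image hc ⟨w, hw, rfl⟩)
  have hnhds : {w : W | (p.1, w) ∈ A}ᶜ ∈ 𝓝 p.2 := hfib.isOpen_compl.mem_nhds hpA
  obtain ⟨Q, hQ, hQc, hQs⟩ := exists_mem_nhds_isClosed_subset hnhds
  have hQ' : (univ ×ˢ Q : Set (Z × W)) ∈ 𝓝 p := by
    rw [← Prod.mk.eta (p := p)]
    exact prod_mem_nhds Filter.univ_mem hQ
  have hQ'c : IsClosed (univ ×ˢ Q : Set (Z × W)) := isClosed_univ.prod hQc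
  have hcl : IsClosed (Prod.fst '' (A ∩ univ ×ˢ Q)) :=
    key _ fun C hC hCc => subset_inter (hA C (hC.trans inter_subset_left) hCc)
      (closure_minimal (hC.trans inter_subset_right) hQ'c)
  have hpQ : p ∈ closure (A ∩ univ ×ˢ Q) := by
    rw [mem_closure_iff_nhds] at hp ⊢
    intro t ht
    obtain ⟨z, hz⟩ := hp _ (Filter.inter_mem ht hQ')
    exact ⟨z, hz.1.1, hz.2, hz.1.2⟩
  have : p.1 ∈ Prod.fst '' (A ∩ univ ×ˢ Q) := by
    rw [← hcl.closure_eq]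
    exact image_closure_subset_closure_image continuous_fst ⟨p, hpQ, rfl⟩
  obtain ⟨⟨a, b⟩, ⟨h1, h2⟩, h3⟩ := this
  simp only at h3
  subst h3
  exact hQs h2.2 h1

theorem IsCountablyTight.pi_fin {X : Type*} [TopologicalSpace X] [CompactSpace X] [T2Space X]
    (hX : IsCountablyTight X) (n : ℕ) : IsCountablyTight (Fin n → X) := by
  induction n with
  | zero => exact fun A _ => A.toFinite.isClosed
  | succ n ih =>
    refine (hX.prod ih).of_continuous_surjective
      (f := fun p : X × (Fin n → X) => (Fin.cons p.1 p.2 : Fin (n + 1) → X)) ?_ ?_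
    · refine continuous_pi fun i => ?_
      refine Fin.cases ?_ (fun j => ?_) i
      · simpa using continuous_fst
      · simp only [Fin.cons_succ]
        fun_prop
    · exact fun f => ⟨(f 0, Fin.tail f), Fin.cons_self_tail f⟩

/-- A sequence indexed by a well-order with countable initial segments can be built by choosing
each term according to the countable set of its predecessors. -/
theorem exists_forall_image_Iio {I : Type*} [LinearOrder I] [WellFoundedLT I]
    (hI : ∀ i : I, (Iio i).Countable) {α : Type*} (P : Set α → α → Prop)
    (hP : ∀ C : Set α, C.Countable → ∃ x, P C x) : ∃ f : I → α, ∀ i, P (f '' Iio i) (f i) := by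
  classical
  have hne : Nonempty α := let ⟨x, _⟩ := hP ∅ countable_empty; ⟨x⟩
  choose! g hg using hP
  let F : ∀ i : I, (∀ j, j < i → α) → α := fun i f => g (range fun j : Iio i => f j j.2)
  let f : I → α := WellFounded.fix (wellFounded_lt (α := I)) F
  refine ⟨f, fun i => ?_⟩
  have : f i = g (f '' Iio i) := by
    rw [image_eq_range]
    exact WellFounded.fix_eq _ F i
  rw [this]
  exact hg _ ((hI i).image f)

theorem exists_gt_of_countable {I : Type*} [LinearOrder I] [Uncountable I]
    (hI : ∀ i : I, (Iio i).Countable) {C : Set I} (hC : C.Countable) : ∃ δ, ∀ ξ ∈ C, ξ < δ := by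
  by_contra! h
  refine not_countable_univ (α := I) ((hC.biUnion fun ξ _ => (hI ξ).insert ξ).mono fun δ _ => ?_)
  obtain ⟨ξ, hξ, hle⟩ := h δ
  refine mem_biUnion hξ ?_
  rcases hle.eq_or_lt with h | h
  · exact Or.inl h
  · exact Or.inr h

theorem IsCountablyTight.of_countable_discrete {I : Type*} [LinearOrder I] [WellFoundedLT I]
    (hI : ∀ i : I, (Iio i).Countable) {X : Type*} [TopologicalSpace X] [CompactSpace X] [T2Space X]
    (hX : ∀ (x : I → X) (V : I → Set X), (∀ i, IsOpen (V i)) → (∀ i, x i ∈ V i) →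
      (∀ i j, i ≠ j → x i ∉ V j) → False) : IsCountablyTight X := by
  intro A hA
  refine isClosed_of_closure_subset fun p hp => ?_
  by_contra hpA
  let α := {q : X × Set X // q.1 ∈ A ∧ IsOpen q.2 ∧ p ∈ q.2}
  let P : Set α → α → Prop := fun C q => q.1.1 ∉ closure ((fun r : α => r.1.1) '' C) ∧
    q.1.1 ∉ closure q.1.2 ∧ ∀ r ∈ C, q.1.1 ∈ closure r.1.2
  have hP : ∀ C : Set α, C.Countable → ∃ q, P C q := by
    intro C hC
    have sep : ∀ D : Set X, IsClosed D → p ∉ D →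
        ∃ O, IsOpen O ∧ p ∈ O ∧ Disjoint D (closure O) := by
      intro D hD hpD
      obtain ⟨Q, hQ, hQc, hQs⟩ := exists_mem_nhds_isClosed_subset (hD.isOpen_compl.mem_nhds hpD)
      refine ⟨interior Q, isOpen_interior, mem_interior_iff_mem_nhds.2 hQ, ?_⟩
      refine Disjoint.mono_right ((closure_mono interior_subset).trans hQc.closure_subset) ?_
      exact (subset_compl_iff_disjoint_left.1 hQs)
    have hKA : closure ((fun r : α => r.1.1) '' C) ⊆ A :=
      hA _ (by rintro _ ⟨r, -, rfl⟩; exact r.2.1) (hC.image _)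
    obtain ⟨O₀, hO₀, hpO₀, hd₀⟩ := sep _ isClosed_closure fun h => hpA (hKA h)
    obtain ⟨u, hu⟩ : ∃ u : ℕ → Set X, insert O₀ ((fun r : α => r.1.2) '' C) = range u :=
      ((hC.image _).insert O₀).exists_eq_range (insert_nonempty _ _)
    have hu' : ∀ n, IsOpen (u n) ∧ p ∈ u n := by
      intro n
      have : u n ∈ insert O₀ ((fun r : α => r.1.2) '' C) := hu ▸ mem_range_self n
      rcases this with h | ⟨r, -, h⟩
      · exact h ▸ ⟨hO₀, hpO₀⟩
      · exact h ▸ r.2.2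
    have ha : ∀ n, ∃ a ∈ A, ∀ i ≤ n, a ∈ u i := by
      intro n
      obtain ⟨a, h1, h2⟩ := mem_closure_iff.1 hp (⋂ i ∈ Finset.range (n + 1), u i)
        (isOpen_biInter_finset fun i _ => (hu' i).1) (mem_iInter₂.2 fun i _ => (hu' i).2)
      refine ⟨a, h2, fun i hi => ?_⟩
      exact mem_iInter₂.1 h1 i (Finset.mem_range.2 (Nat.lt_succ_of_le hi))
    choose a haA ha using ha
    obtain ⟨x, hx⟩ : ∃ x, MapClusterPt x Filter.atTop a := exists_clusterPt_of_compactSpace _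
    have hxA : x ∈ A := hA (range a) (range_subset_iff.2 haA) (countable_range a)
      (mem_closure_of_mapClusterPt hx (Filter.Eventually.of_forall mem_range_self))
    have hxu : ∀ i, x ∈ closure (u i) := fun i => by
      refine mem_closure_of_mapClusterPt hx ?_
      filter_upwards [Filter.eventually_ge_atTop i] with n hn using ha n i hn
    obtain ⟨O, hO, hpO, hd⟩ := sep {x} isClosed_singleton (by
      rintro rfl; exact hpA hxA)
    refine ⟨⟨(x, O), hxA, hO, hpO⟩, ?_, ?_, ?_⟩
    · intro h
      obtain ⟨n, hn⟩ : O₀ ∈ range u := hu ▸ mem_insert _ _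
      exact disjoint_left.1 hd₀ h (hn ▸ hxu n)
    · exact disjoint_left.1 hd rfl
    · intro r hr
      obtain ⟨n, hn⟩ : r.1.2 ∈ range u := hu ▸ Or.inr ⟨r, hr, rfl⟩
      exact hn ▸ hxu n
  obtain ⟨f, hf⟩ := exists_forall_image_Iio hI P hP
  refine hX (fun i => (f i).1.1)
    (fun i => (closure ((fun r : α => r.1.1) '' (f '' Iio i)))ᶜ ∩ (closure (f i).1.2)ᶜ)
    (fun i => isClosed_closure.isOpen_compl.inter isClosed_closure.isOpen_compl)
    (fun i => ⟨(hf i).1, (hf i).2.1⟩) fun i j hij hmem => ?_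
  rcases lt_or_gt_of_ne hij with h | h
  · exact hmem.1 (subset_closure ⟨f i, ⟨i, h, rfl⟩, rfl⟩)
  · exact hmem.2 ((hf i).2.2 (f j) ⟨j, h, rfl⟩)

/-- In a countably tight compact space every `ω₁`-sequence has a point that lies both in the closure
of an initial segment and in the closure of every final segment. -/
theorem IsCountablyTight.exists_mem_closure_image {I : Type*} [LinearOrder I] [Uncountable I]
    (hI : ∀ i : I, (Iio i).Countable) {Z : Type*} [TopologicalSpace Z] [CompactSpace Z]
    (hZ : IsCountablyTight Z) (h : I → Z) :
    ∃ (y : Z) (δ : I), y ∈ closure (h '' Iio δ) ∧ ∀ ζ, y ∈ closure (h '' Ici ζ) := by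
  have : Nonempty I := inferInstance
  obtain ⟨y, hy⟩ : ∃ y, MapClusterPt y Filter.atTop h := exists_clusterPt_of_compactSpace _
  have htail : ∀ ζ, y ∈ closure (h '' Ici ζ) := fun ζ =>
    mem_closure_of_mapClusterPt hy (by
      filter_upwards [Filter.eventually_ge_atTop ζ] with n hn using ⟨n, hn, rfl⟩)
  obtain ⟨ζ⟩ := this
  obtain ⟨C, hCs, hC, hyC⟩ := hZ.exists_countable_mem_closure (htail ζ)
  have hCs' : ∀ c ∈ C, ∃ i, i ∈ Ici ζ ∧ h i = c := fun c hc => hCs hc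
  choose! g hg hgh using hCs'
  obtain ⟨δ, hδ⟩ := exists_gt_of_countable hI (hC.image g)
  have hCδ : C ⊆ h '' Iio δ := fun c hc => ⟨g c, hδ _ ⟨c, hc, rfl⟩, hgh c hc⟩
  exact ⟨y, δ, closure_mono hCδ hyC, htail⟩

/-- Under Martin's Axiom, a symmetric relation on a set of size less than the continuum whose
poset of finite cliques is ccc has an uncountable clique. -/
theorem MartinsAxiom.exists_uncountable_pairwise (hMA : MartinsAxiom) {I : Type} [LinearOrder I]
    [WellFoundedLT I] [Uncountable I] (hI : ∀ i : I, (Iio i).Countable)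
    (hcard : Cardinal.mk I < Cardinal.continuum) (r : I → I → Prop)
    (hccc : ∀ 𝒜 : Set (Finset I), (∀ H ∈ 𝒜, (H : Set I).Pairwise r) →
      (∀ H ∈ 𝒜, ∀ K ∈ 𝒜, H ≠ K → ¬ ((H : Set I) ∪ K).Pairwise r) → 𝒜.Countable) :
    ∃ D : Set I, ¬ D.Countable ∧ D.Pairwise r := by
  classical
  obtain ⟨p, hp, hpext⟩ : ∃ p : Finset I, (p : Set I).Pairwise r ∧ ∀ q : Finset I,
      (q : Set I).Pairwise r → p ⊆ q → ∀ α, ∃ s : Finset I, (s : Set I).Pairwise r ∧ q ⊆ s ∧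
        ∃ β ∈ s, α ≤ β := by
    by_contra! hcon
    have hsing : ∀ β : I, ((({β} : Finset I)) : Set I).Pairwise r := fun β => by simp
    choose q hq hβq b hb using fun β => hcon {β} (hsing β)
    obtain ⟨f, hf⟩ := exists_forall_image_Iio hI (fun (C : Set I) x => ∀ c ∈ C, b c ≤ x)
      (fun C hC => by
        obtain ⟨δ, hδ⟩ := exists_gt_of_countable hI (hC.image b)
        exact ⟨δ, fun c hc => (hδ _ ⟨c, hc, rfl⟩).le⟩)
    have hmem : ∀ β, β ∈ q β := fun β => hβq β (Finset.mem_singleton_self β)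
    have hinc : ∀ i j, i < j → ¬ ((q (f i) : Set I) ∪ q (f j)).Pairwise r := by
      intro i j hij h
      have := hb (f i) (q (f i) ∪ q (f j)) (by simpa using h) Finset.subset_union_left (f j)
        (Finset.mem_union_right _ (hmem _))
      exact absurd (hf j (f i) ⟨i, hij, rfl⟩) (not_le.2 this)
    have hinc' : ∀ i j, i ≠ j → ¬ ((q (f i) : Set I) ∪ q (f j)).Pairwise r := by
      intro i j hij
      rcases lt_or_gt_of_ne hij with h | h
      · exact hinc i j h
      · rw [union_comm]; exact hinc j i h
    have hinj : Function.Injective fun i => q (f i) := by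
      intro i j hij
      by_contra hne
      apply hinc' i j hne
      simp only at hij
      rw [hij, union_self]
      exact hq _
    have hc := hccc (range fun i => q (f i)) (by rintro _ ⟨i, rfl⟩; exact hq _) (by
      rintro _ ⟨i, rfl⟩ _ ⟨j, rfl⟩ hne
      exact hinc' i j fun h => hne (h ▸ rfl))
    rw [← image_univ] at hc
    exact not_countable_univ (countable_of_injective_of_countable_image hinj.injOn hc)
  let P := {H : Finset I // (H : Set I).Pairwise r ∧ p ⊆ H}
  let po : PartialOrder P := PartialOrder.lift (fun H : P => OrderDual.toDual H.1)
    (fun a b h => Subtype.ext (OrderDual.toDual.injective h))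
  have hle : ∀ H K : P, po.le H K ↔ K.1 ⊆ H.1 := fun _ _ => Iff.rfl
  obtain ⟨G, -, -, hGdir, hGD⟩ := hMA P po ⟨⟨p, hp, Finset.Subset.refl p⟩⟩ (by
      intro A hA
      refine countable_of_injective_of_countable_image Subtype.val_injective.injOn
        (hccc (Subtype.val '' A) ?_ ?_)
      · rintro _ ⟨H, -, rfl⟩
        exact H.2.1
      · rintro _ ⟨H, hH, rfl⟩ _ ⟨K, hK, rfl⟩ hne hpair
        refine hA H hH K hK (fun h => hne (h ▸ rfl)) ⟨⟨H.1 ∪ K.1, by simpa using hpair,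
          H.2.2.trans Finset.subset_union_left⟩, ?_, ?_⟩
        · exact (hle _ _).2 Finset.subset_union_left
        · exact (hle _ _).2 Finset.subset_union_right)
    (range fun α : I => {H : P | ∃ β ∈ H.1, α ≤ β}) (Cardinal.mk_range_le.trans_lt hcard) (by
      rintro _ ⟨α, rfl⟩ H
      obtain ⟨s, hs, hHs, hβ⟩ := hpext H.1 H.2.1 H.2.2 α
      exact ⟨⟨s, hs, H.2.2.trans hHs⟩, hβ, (hle _ _).2 hHs⟩)
  refine ⟨⋃ H ∈ G, (H.1 : Set I), fun hc => ?_, ?_⟩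
  · obtain ⟨δ, hδ⟩ := exists_gt_of_countable hI hc
    obtain ⟨H, hHG, β, hβ, hle⟩ := hGD _ ⟨δ, rfl⟩
    exact absurd (hδ β (mem_biUnion hHG hβ)) (not_lt.2 hle)
  · intro a ha b hb hab
    obtain ⟨H, hH, haH⟩ := mem_iUnion₂.1 ha
    obtain ⟨K, hK, hbK⟩ := mem_iUnion₂.1 hb
    obtain ⟨L, -, hLH, hLK⟩ := hGdir H hH K hK
    exact L.2.1 ((hle _ _).1 hLH haH) ((hle _ _).1 hLK hbK) hab

/-- In a countably tight compact space, consider a left- or right-separated `ω₁`-sequence of points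
with closed neighbourhoods. The poset of finite discrete subfamilies is ccc. -/
theorem IsCountablyTight.countable_of_incompatible {I : Type*} [LinearOrder I] [WellFoundedLT I]
    [Uncountable I] (hI : ∀ i : I, (Iio i).Countable) {X : Type*} [TopologicalSpace X]
    [CompactSpace X] [T2Space X] (hX : IsCountablyTight X) (x : I → X) (C W : I → Set X)
    (hC : ∀ i, IsClosed (C i)) (hW : ∀ i, IsOpen (W i)) (hCW : ∀ i, C i ⊆ W i)
    (hsep : (∀ i j, i < j → x j ∉ W i) ∨ (∀ i j, i < j → x i ∉ W j)) (n : ℕ)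
    (𝒜 : Set (Finset I)) (hcard : ∀ H ∈ 𝒜, H.card = n)
    (hinc : ∀ H ∈ 𝒜, ∀ K ∈ 𝒜, H ≠ K → ∃ a ∈ H, ∃ b ∈ K, a ∉ K ∧ b ∉ H ∧ (x a ∈ C b ∨ x b ∈ C a)) :
    𝒜.Countable := by
  classical
  induction n using Nat.strong_induction_on generalizing 𝒜 with
  | _ n ih =>
  by_contra hunc
  by_cases hα : ∃ α, ¬ {H ∈ 𝒜 | α ∈ H}.Countable
  · obtain ⟨α, hα⟩ := hα
    obtain ⟨H₀, hH₀, hαH₀⟩ : {H ∈ 𝒜 | α ∈ H}.Nonempty := by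
      by_contra h
      rw [not_nonempty_iff_eq_empty] at h
      exact hα (h ▸ countable_empty)
    have hn : 0 < n := by
      rw [← hcard H₀ hH₀]
      exact Finset.card_pos.2 ⟨α, hαH₀⟩
    have hinj : InjOn (fun H : Finset I => H.erase α) {H ∈ 𝒜 | α ∈ H} := by
      intro H hH K hK h
      simp only at h
      rw [← Finset.insert_erase hH.2, h, Finset.insert_erase hK.2]
    refine hα (countable_of_injective_of_countable_image hinj (ih (n - 1) (by omega) _ ?_ ?_))
    · rintro _ ⟨H, hH, rfl⟩
      simp only
      rw [Finset.card_erase_of_mem hH.2, hcard H hH.1]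
    · rintro _ ⟨H, hH, rfl⟩ _ ⟨K, hK, rfl⟩ hne
      obtain ⟨a, ha, b, hb, haK, hbH, hab⟩ := hinc H hH.1 K hK.1 (fun h => hne (h ▸ rfl))
      refine ⟨a, Finset.mem_erase.2 ⟨?_, ha⟩, b, Finset.mem_erase.2 ⟨?_, hb⟩,
        fun h => haK (Finset.mem_of_mem_erase h), fun h => hbH (Finset.mem_of_mem_erase h), hab⟩
      · rintro rfl; exact haK hK.2
      · rintro rfl; exact hbH hH.2
  push Not at hα
  obtain ⟨f, hf⟩ := exists_forall_image_Iio hI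
    (fun (𝒞 : Set 𝒜) (H : 𝒜) => H ∉ 𝒞 ∧ ∀ K ∈ 𝒞, ∀ a ∈ K.1, ∀ b ∈ H.1, a < b) (by
      intro 𝒞 h𝒞
      obtain ⟨δ, hδ⟩ := exists_gt_of_countable hI
        (h𝒞.biUnion fun K _ => K.1.countable_toSet)
      have h1 : (Subtype.val '' 𝒞 ∪ ⋃ b ∈ insert δ (Iio δ), {H ∈ 𝒜 | b ∈ H}).Countable :=
        (h𝒞.image _).union (((hI δ).insert δ).biUnion fun b _ => hα b)
      obtain ⟨H, hH, hH'⟩ : ∃ H ∈ 𝒜, H ∉ Subtype.val '' 𝒞 ∪ ⋃ b ∈ insert δ (Iio δ),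
          {H ∈ 𝒜 | b ∈ H} := by
        by_contra! h
        exact hunc (h1.mono h)
      refine ⟨⟨H, hH⟩, fun h => hH' (Or.inl ⟨_, h, rfl⟩), fun K hK a ha b hb => ?_⟩
      by_contra hlt
      have hb' : b < δ := (not_lt.1 hlt).trans_lt (hδ a (mem_biUnion hK ha))
      exact hH' (Or.inr (mem_biUnion (Or.inr hb') ⟨hH, hb⟩)))
  let e : ∀ ξ, Fin n ↪o I := fun ξ => (f ξ).1.orderEmbOfFin (hcard _ (f ξ).2)
  have he : ∀ ξ i, e ξ i ∈ (f ξ).1 := fun ξ i => Finset.orderEmbOfFin_mem _ _ i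
  have he' : ∀ ξ, ∀ a ∈ (f ξ).1, ∃ i, e ξ i = a := by
    intro ξ a ha
    have : a ∈ range (e ξ) := by rw [Finset.range_orderEmbOfFin]; exact ha
    exact this
  have hlt : ∀ ξ η, ξ < η → ∀ i j, e ξ i < e η j := fun ξ η h i j =>
    (hf η).2 (f ξ) ⟨ξ, h, rfl⟩ _ (he ξ i) _ (he η j)
  have hpair : ∀ ξ η, ξ < η → ∃ i j, x (e ξ i) ∈ C (e η j) ∨ x (e η j) ∈ C (e ξ i) := by
    intro ξ η h
    obtain ⟨a, ha, b, hb, -, -, hab⟩ := hinc _ (f ξ).2 _ (f η).2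
      (fun heq => (hf η).1 ⟨ξ, h, Subtype.ext heq⟩)
    obtain ⟨i, rfl⟩ := he' ξ a ha
    obtain ⟨j, rfl⟩ := he' η b hb
    exact ⟨i, j, hab⟩
  let h : I → Fin n → X := fun ξ i => x (e ξ i)
  obtain ⟨y, δ, hyδ, hy⟩ := (hX.pi_fin n).exists_mem_closure_image hI h
  obtain ⟨ζ, hζ⟩ := exists_gt_of_countable hI (countable_singleton δ)
  have hδζ : δ < ζ := hζ δ rfl
  let K : Set (Fin n → X) := {z | ∃ i j, z i ∈ C (e δ j)}
  have hK : IsClosed K := by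
    have : K = ⋃ i, ⋃ j, (fun z : Fin n → X => z i) ⁻¹' C (e δ j) := by
      ext z; simp [K]
    rw [this]
    exact isClosed_iUnion_of_finite fun i => isClosed_iUnion_of_finite fun j =>
      (hC _).preimage (continuous_apply i)
  have hnhds : ∀ S : Set (Fin n → X), y ∈ closure S → y ∈ K →
      ∃ z ∈ S, ∃ i j, z i ∈ W (e δ j) := by
    rintro S hS ⟨i, j, hij⟩
    obtain ⟨z, hz, hzS⟩ := mem_closure_iff.1 hS ((fun z : Fin n → X => z i) ⁻¹' W (e δ j))
      ((hW _).preimage (continuous_apply i)) (hCW _ hij)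
    exact ⟨z, hzS, i, j, hz⟩
  rcases hsep with hsep | hsep
  · have hyK : y ∈ K := by
      refine closure_minimal ?_ hK hyδ
      rintro _ ⟨ξ, hξ, rfl⟩
      obtain ⟨i, j, hij | hij⟩ := hpair ξ δ hξ
      · exact ⟨i, j, hij⟩
      · exact absurd (hCW _ hij) (hsep _ _ (hlt ξ δ hξ i j))
    obtain ⟨_, ⟨ξ, hξ, rfl⟩, i, j, hij⟩ := hnhds _ (hy ζ) hyK
    exact hsep _ _ (hlt δ ξ (hδζ.trans_le hξ) j i) hij
  · have hyK : y ∈ K := by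
      refine closure_minimal ?_ hK (hy ζ)
      rintro _ ⟨ξ, hξ, rfl⟩
      obtain ⟨i, j, hij | hij⟩ := hpair δ ξ (hδζ.trans_le hξ)
      · exact absurd (hCW _ hij) (hsep _ _ (hlt δ ξ (hδζ.trans_le hξ) i j))
      · exact ⟨j, i, hij⟩
    obtain ⟨_, ⟨ξ, hξ, rfl⟩, i, j, hij⟩ := hnhds _ hyδ hyK
    exact hsep _ _ (hlt ξ δ hξ i j) hij

/-- Szentmiklóssy's theorem: under Martin's Axiom, a compact space with an uncountable left- or
right-separated sequence contains an uncountable discrete subspace. -/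
theorem MartinsAxiom.exists_uncountable_discrete (hMA : MartinsAxiom) {I : Type} [LinearOrder I]
    [WellFoundedLT I] [Uncountable I] (hI : ∀ i : I, (Iio i).Countable)
    (hcard : Cardinal.mk I < Cardinal.continuum) {X : Type*} [TopologicalSpace X]
    [CompactSpace X] [T2Space X] (hX : IsCountablyTight X) (x : I → X) (W : I → Set X)
    (hW : ∀ i, IsOpen (W i)) (hxW : ∀ i, x i ∈ W i)
    (hsep : (∀ i j, i < j → x j ∉ W i) ∨ (∀ i j, i < j → x i ∉ W j)) :
    ∃ (D : Set I) (V : I → Set X), ¬ D.Countable ∧ (∀ i, IsOpen (V i)) ∧ (∀ i, x i ∈ V i) ∧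
      ∀ i ∈ D, ∀ j ∈ D, i ≠ j → x i ∉ V j := by
  classical
  choose C hCn hC hCW using fun i => exists_mem_nhds_isClosed_subset ((hW i).mem_nhds (hxW i))
  obtain ⟨D, hDc, hD⟩ := hMA.exists_uncountable_pairwise hI hcard
    (fun i j => x i ∉ C j ∧ x j ∉ C i) (by
      intro 𝒜 h𝒜 hinc
      have hU : 𝒜 = ⋃ n, {H ∈ 𝒜 | H.card = n} := by ext; simp
      rw [hU]
      refine countable_iUnion fun n => hX.countable_of_incompatible hI x C W hC hW hCW hsep n _
        (fun H hH => hH.2) fun H hH K hK hne => ?_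
      have hHK := hinc H hH.1 K hK.1 hne
      contrapose! hHK
      intro a ha b hb hab
      by_cases haK : a ∈ K
      · by_cases hbK : b ∈ K
        · exact h𝒜 K hK.1 haK hbK hab
        have hbH : b ∈ H := hb.resolve_right hbK
        by_cases haH : a ∈ H
        · exact h𝒜 H hH.1 haH hbH hab
        exact (hHK b hbH a haK hbK haH).symm
      · have haH : a ∈ H := ha.resolve_right haK
        by_cases hbH : b ∈ H
        · exact h𝒜 H hH.1 haH hbH hab
        exact hHK a haH b (hb.resolve_left hbH) haK hbH)
  exact ⟨D, fun i => interior (C i), hDc, fun i => isOpen_interior,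
    fun i => mem_interior_iff_mem_nhds.2 (hCn i),
    fun i hi j hj hij hmem => (hD hi hj hij).1 (interior_subset hmem)⟩

/-- Under Martin's Axiom, partial functions on an almost-independent family of subsets of `ℕ` can be
simultaneously uniformized, modulo finite sets, along a set meeting each member in an infinite
set. -/
theorem MartinsAxiom.exists_uniformization (hMA : MartinsAxiom) {J T : Type}
    (hcard : Cardinal.mk J < Cardinal.continuum) [Countable T] (a b : J → Set ℕ)
    (hab : ∀ α (H : Finset J), α ∉ H → (a α \ ⋃ β ∈ H, b β).Infinite) (g : J → ℕ → T) :
    ∃ (E : Set ℕ) (t : E → T), (∀ α, (E ∩ a α).Infinite) ∧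
      ∀ α, ∃ k, ∀ n : E, k ≤ n.1 → n.1 ∈ b α → t n = g α n := by
  classical
  let P := Finset (ℕ × T) × Finset J
  let le : P → P → Prop := fun q p => p.1 ⊆ q.1 ∧ p.2 ⊆ q.2 ∧
    ∀ x ∈ q.1, x ∉ p.1 → ∀ α ∈ p.2, x.1 ∈ b α → x.2 = g α x.1
  let po : PartialOrder P :=
    { le := le
      lt := fun q p => le q p ∧ ¬ le p q
      le_refl := fun p => ⟨Finset.Subset.refl _, Finset.Subset.refl _, fun x h h' => absurd h h'⟩
      le_trans := fun r q p hrq hqp => ⟨hqp.1.trans hrq.1, hqp.2.1.trans hrq.2.1,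
        fun x hx hxp α hα hb => by
          by_cases hxq : x ∈ q.1
          · exact hqp.2.2 x hxq hxp α hα hb
          · exact hrq.2.2 x hx hxq α (hqp.2.1 hα) hb⟩
      le_antisymm := fun q p hqp hpq => Prod.ext (hpq.1.antisymm hqp.1)
        (hpq.2.1.antisymm hqp.2.1) }
  have hle : ∀ q p : P, po.le q p ↔ p.1 ⊆ q.1 ∧ p.2 ⊆ q.2 ∧
        ∀ x ∈ q.1, x ∉ p.1 → ∀ α ∈ p.2, x.1 ∈ b α → x.2 = g α x.1 := fun _ _ => Iff.rfl
  obtain ⟨G, -, -, hGdir, hGD⟩ := hMA P po ⟨(∅, ∅)⟩ (by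
      intro A hA
      refine countable_of_injective_of_countable_image (f := Prod.fst) ?_ (to_countable _)
      intro p hp q hq hpq
      by_contra hne
      refine hA p hp q hq hne ⟨(p.1, p.2 ∪ q.2), (hle _ _).2 ⟨Finset.Subset.refl _,
        Finset.subset_union_left, fun x h h' => absurd h h'⟩, (hle _ _).2 ⟨hpq ▸
          Finset.Subset.refl _, Finset.subset_union_right, fun x h h' => absurd (hpq ▸ h) h'⟩⟩)
    (range fun αm : J × ℕ => {p : P | αm.1 ∈ p.2 ∧ ∃ x ∈ p.1, αm.2 ≤ x.1 ∧ x.1 ∈ a αm.1})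
    (Cardinal.mk_range_le.trans_lt (by
      rw [Cardinal.mk_prod]
      simpa using Cardinal.mul_lt_of_lt Cardinal.aleph0_le_continuum hcard
        Cardinal.aleph0_lt_continuum)) (by
      rintro _ ⟨⟨α, m⟩, rfl⟩ p
      obtain ⟨n, ⟨hna, hnb⟩, hmn⟩ := (hab α (p.2.erase α) (by simp)).exists_gt m
      refine ⟨(insert (n, g α n) p.1, insert α p.2), ⟨by simp, (n, g α n), by simp, hmn.le, hna⟩,
        (hle _ _).2 ⟨Finset.subset_insert _ _, Finset.subset_insert _ _, ?_⟩⟩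
      intro x hx hxp β hβ hxb
      obtain rfl := (Finset.mem_insert.1 hx).resolve_right hxp
      by_cases h : β = α
      · subst h; rfl
      · exact absurd (mem_biUnion (Finset.mem_coe.2 (Finset.mem_erase.2 ⟨h, hβ⟩)) hxb) hnb)
  have hE : ∀ n : {n : ℕ | ∃ τ, ∃ p ∈ G, (n, τ) ∈ p.1}, ∃ τ, ∃ p ∈ G, (n.1, τ) ∈ p.1 :=
    fun n => n.2
  choose t ht using hE
  refine ⟨_, t, fun α => ?_, fun α => ?_⟩
  · refine infinite_of_not_bddAbove ?_
    rintro ⟨m, hm⟩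
    obtain ⟨p, hpG, -, ⟨n, τ⟩, hx, hmx, hxa⟩ := hGD _ ⟨(α, m + 1), rfl⟩
    have := hm ⟨⟨τ, p, hpG, hx⟩, hxa⟩
    simp only at hmx
    omega
  · obtain ⟨p, hpG, hα, -⟩ := hGD _ ⟨(α, 0), rfl⟩
    refine ⟨p.1.sup Prod.fst + 1, fun n hn hnb => ?_⟩
    obtain ⟨q, hqG, hq⟩ := ht n
    obtain ⟨r, -, hrp, hrq⟩ := hGdir p hpG q hqG
    refine ((hle _ _).1 hrp).2.2 _ (((hle _ _).1 hrq).1 hq) (fun h => ?_) α hα hnb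
    have : n.1 ≤ p.1.sup Prod.fst := Finset.le_sup (f := Prod.fst) h
    omega

theorem Set.Finite.exists_subset_pair {α : Type*} {T : Set α} (hT : T.Finite) (h2 : T.ncard ≤ 2)
    (hne : T.Nonempty) : ∃ s ∈ T, ∃ t ∈ T, T ⊆ {s, t} := by
  obtain ⟨s, hs⟩ := hne
  have h : (T \ {s}).ncard ≤ 1 := by
    rw [ncard_sdiff_singleton_of_mem hs]
    omega
  rcases (T \ {s}).eq_empty_or_nonempty with h0 | ⟨t, ht⟩
  · exact ⟨s, hs, s, hs, fun x hx => by
      by_contra hxs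
      exact (h0 ▸ (⟨hx, fun h => hxs (Or.inl h)⟩ : x ∈ T \ {s}) : x ∈ (∅ : Set α))⟩
  · refine ⟨s, hs, t, ht.1, fun x hx => ?_⟩
    by_cases hxs : x = s
    · exact Or.inl hxs
    · exact Or.inr (ncard_le_one_iff (hT.subset sdiff_subset) |>.1 h ⟨hx, hxs⟩ ht)

theorem IsSupercompact.compactSpace {X : Type*} [t : TopologicalSpace X] (hX : IsSupercompact X) :
    CompactSpace X := by
  obtain ⟨S, hS, h⟩ := hX
  refine compactSpace_generateFrom hS.symm fun C hC hU => ?_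
  obtain ⟨T, hTC, hT, -, hTU⟩ := h C hC hU
  exact ⟨T, hTC, hT, hTU⟩

/-- A supercompact space has a family of closed sets with the three-set Helly property that is rich
enough to approximate closed sets from above by finite unions. -/
theorem IsSupercompact.exists_closed_family {Y : Type*} [t : TopologicalSpace Y]
    (hY : IsSupercompact Y) : ∃ 𝒞 : Set (Set Y), (∀ C ∈ 𝒞, IsClosed C) ∧
      (∀ K O : Set Y, IsClosed K → IsOpen O → K ⊆ O →
        ∃ 𝓕 ⊆ 𝒞, 𝓕.Finite ∧ K ⊆ ⋃₀ 𝓕 ∧ ⋃₀ 𝓕 ⊆ O) ∧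
      ∀ A ∈ 𝒞, ∀ B ∈ 𝒞, ∀ C ∈ 𝒞, (A ∩ B).Nonempty → (A ∩ C).Nonempty → (B ∩ C).Nonempty →
        (A ∩ B ∩ C).Nonempty := by
  have := hY.compactSpace
  obtain ⟨S, hS, hcov⟩ := hY
  let 𝒞 : Set (Set Y) := {C | ∃ 𝒢 ⊆ S, C = (⋃₀ 𝒢)ᶜ}
  have hopen : ∀ s ∈ S, IsOpen s := fun s hs => hS ▸ isOpen_generateFrom_of_mem hs
  refine ⟨𝒞, ?_, ?_, ?_⟩
  · rintro _ ⟨𝒢, h𝒢, rfl⟩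
    exact (isOpen_sUnion fun s hs => hopen s (h𝒢 hs)).isClosed_compl
  · intro K O hK hO hKO
    obtain ⟨𝓕, h𝓕, hfin, hK𝓕, hd⟩ : ∃ 𝓕 ⊆ 𝒞, 𝓕.Finite ∧ K ⊆ ⋃₀ 𝓕 ∧ Disjoint (⋃₀ 𝓕) Oᶜ := by
      refine hO.isClosed_compl.isCompact.induction_on
        (p := fun Q => ∃ 𝓕 ⊆ 𝒞, 𝓕.Finite ∧ K ⊆ ⋃₀ 𝓕 ∧ Disjoint (⋃₀ 𝓕) Q) ?_ ?_ ?_ ?_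
      · exact ⟨{univ}, by simpa using ⟨∅, empty_subset _, by simp⟩, finite_singleton _, by simp,
          by simp⟩
      · rintro Q R hQR ⟨𝓕, h1, h2, h3, h4⟩
        exact ⟨𝓕, h1, h2, h3, h4.mono_right hQR⟩
      · rintro Q R ⟨𝓕, h1, h2, h3, h4⟩ ⟨𝓖, g1, g2, g3, g4⟩
        refine ⟨image2 (· ∩ ·) 𝓕 𝓖, ?_, h2.image2 _ g2, ?_, ?_⟩
        · rintro _ ⟨A, hA, B, hB, rfl⟩
          obtain ⟨𝒢, h𝒢, rfl⟩ := h1 hA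
          obtain ⟨ℋ, hℋ, rfl⟩ := g1 hB
          exact ⟨𝒢 ∪ ℋ, union_subset h𝒢 hℋ, by rw [sUnion_union, compl_union]⟩
        · intro x hx
          obtain ⟨A, hA, hxA⟩ := h3 hx
          obtain ⟨B, hB, hxB⟩ := g3 hx
          exact ⟨A ∩ B, ⟨A, hA, B, hB, rfl⟩, hxA, hxB⟩
        · rw [disjoint_left] at h4 g4 ⊢
          rintro x ⟨_, ⟨A, hA, B, hB, rfl⟩, hxA, hxB⟩ (hx | hx)
          · exact h4 ⟨A, hA, hxA⟩ hx
          · exact g4 ⟨B, hB, hxB⟩ hx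
      · intro y hy
        obtain ⟨_, ⟨f, ⟨hf, hfS⟩, rfl⟩, hyf, hfK⟩ :=
          (isTopologicalBasis_of_subbasis hS.symm).exists_subset_of_mem_open
            (show y ∈ Kᶜ from fun h => hy (hKO h)) hK.isOpen_compl
        refine ⟨⋂₀ f, mem_nhdsWithin_of_mem_nhds ((hf.isOpen_sInter fun s hs =>
          hopen s (hfS hs)).mem_nhds hyf), compl '' f, ?_, hf.image _, ?_, ?_⟩
        · rintro _ ⟨s, hs, rfl⟩
          exact ⟨{s}, by simpa using hfS hs, by simp⟩
        · rw [← compl_sInter]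
          exact fun x hx h => hfK h hx
        · rw [← compl_sInter]
          exact disjoint_compl_left
    exact ⟨𝓕, h𝓕, hfin, hK𝓕, disjoint_compl_right_iff_subset.1 hd⟩
  · rintro _ ⟨𝒢, h𝒢, rfl⟩ _ ⟨ℋ, hℋ, rfl⟩ _ ⟨𝒦, h𝒦, rfl⟩ hAB hAC hBC
    by_contra hemp
    rw [not_nonempty_iff_eq_empty, ← compl_union, ← compl_union, compl_empty_iff,
      ← sUnion_union, ← sUnion_union] at hemp
    obtain ⟨T, hTs, hT, hT2, hTU⟩ := hcov _ (union_subset (union_subset h𝒢 hℋ) h𝒦) hemp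
    obtain ⟨x, hx⟩ := hAB
    obtain ⟨s₀, hs₀, -⟩ : x ∈ ⋃₀ T := hTU ▸ mem_univ x
    obtain ⟨s, hs, t, ht, hst⟩ := hT.exists_subset_pair hT2 ⟨s₀, hs₀⟩
    have key : ∀ y, y ∉ s → y ∉ t → False := by
      intro y hys hyt
      obtain ⟨u, hu, hyu⟩ : y ∈ ⋃₀ T := hTU ▸ mem_univ y
      rcases hst hu with rfl | rfl
      · exact hys hyu
      · exact hyt hyu
    obtain ⟨y, hy⟩ := hAC
    obtain ⟨z, hz⟩ := hBC
    simp only [mem_inter_iff, mem_compl_iff, mem_sUnion, not_exists, not_and] at hx hy hz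
    rcases hTs hs with (h | h) | h <;> rcases hTs ht with (h' | h') | h'
    · exact key x (hx.1 _ h) (hx.1 _ h')
    · exact key x (hx.1 _ h) (hx.2 _ h')
    · exact key y (hy.1 _ h) (hy.2 _ h')
    · exact key x (hx.2 _ h) (hx.1 _ h')
    · exact key x (hx.2 _ h) (hx.2 _ h')
    · exact key z (hz.1 _ h) (hz.2 _ h')
    · exact key y (hy.2 _ h) (hy.1 _ h')
    · exact key z (hz.2 _ h) (hz.1 _ h')
    · exact key y (hy.2 _ h) (hy.2 _ h')

theorem exists_not_countable_preimage {J E : Type*} [Uncountable J] [Countable E] (m : J → E) :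
    ∃ e, ¬ (m ⁻¹' {e}).Countable := by
  by_contra! h
  refine not_countable_univ (α := J) ((countable_iUnion h).mono fun α _ => ?_)
  exact mem_iUnion.2 ⟨m α, rfl⟩

/-- A supercompact space cannot contain a countable dense set carrying an uncountable family of open
traces that are uniformized by pairwise different branches of the binary tree. -/
theorem IsSupercompact.false_of_branches {Y : Type*} [TopologicalSpace Y] [T2Space Y]
    (hY : IsSupercompact Y) {E : Set ℕ} (N : E → Y) (hN : DenseRange N)
    {J : Type*} [Uncountable J] (c : J → ℕ → Bool) (hc : Function.Injective c)
    (t : E → List Bool) (U K : J → Set Y) (hU : ∀ α, IsOpen (U α)) (hK : ∀ α, IsClosed (K α))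
    (hKU : ∀ α, K α ⊆ U α) (hKinf : ∀ α, (N ⁻¹' K α).Infinite)
    (ht : ∀ α n, N n ∈ U α → t n = PiNat.res (c α) n) : False := by
  classical
  have hle : ∀ α β d, c α d ≠ c β d → ∀ n : E, N n ∈ U α → N n ∈ U β → n.1 ≤ d := by
    intro α β d hd n hα hβ
    by_contra! h
    exact hd (PiNat.res_eq_res.1 ((ht α n hα).symm.trans (ht β n hβ)) h)
  have hbdd : ∀ d : ℕ, {n : E | n.1 ≤ d}.Finite := fun d =>
    (finite_Iic d).preimage Subtype.val_injective.injOn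
  have hUU : ∀ α β d, c α d ≠ c β d → ∀ y ∈ U α ∩ U β, ∃ n : E, N n = y ∧ n.1 ≤ d := by
    intro α β d hd y hy
    by_contra! h
    obtain ⟨_, ⟨⟨hα, hβ⟩, hn⟩, n, rfl⟩ := hN.inter_open_nonempty
      ((U α ∩ U β) ∩ (N '' {n : E | n.1 ≤ d})ᶜ)
      (((hU α).inter (hU β)).inter ((hbdd d).image N).isClosed.isOpen_compl)
      ⟨y, hy, fun ⟨n, hn, hny⟩ => absurd hn (not_le.2 (h n hny))⟩
    exact hn ⟨n, hle α β d hd n hα hβ, rfl⟩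
  obtain ⟨𝒞, h𝒞, happrox, hHelly⟩ := hY.exists_closed_family
  have hA : ∀ α, ∃ A ∈ 𝒞, A ⊆ U α ∧ (N ⁻¹' A).Infinite := by
    intro α
    obtain ⟨𝓕, h𝓕, hfin, h1, h2⟩ := happrox (K α) (U α) (hK α) (hU α) (hKU α)
    by_contra! h
    refine hKinf α ((hfin.biUnion fun A hA =>
      h A (h𝓕 hA) ((subset_sUnion_of_mem hA).trans h2)).subset fun n hn => ?_)
    obtain ⟨A, hA, hnA⟩ := h1 hn
    exact mem_biUnion hA hnA
  choose A hA𝒞 hAU hAinf using hA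
  choose m hm using fun α => (hAinf α).nonempty
  obtain ⟨n₀, hn₀⟩ := exists_not_countable_preimage m
  let L : Set J := m ⁻¹' {n₀}
  have hL : ∀ α ∈ L, N n₀ ∈ A α := by
    intro α hα
    rw [← (hα : m α = n₀)]
    exact hm α
  obtain ⟨x, hxL, hx⟩ : ∃ x ∈ L, ∀ M, ∃ y ∈ L, y ≠ x ∧ (∀ k < M, c y k = c x k) ∧
      ∀ n : E, n.1 < M → (N n ∈ A y ↔ N n ∈ A x) := by
    by_contra! h
    choose! M hM using h
    refine hn₀ (countable_of_injective_of_countable_image (f := fun x => ((M x : ℕ),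
      PiNat.res (c x) (M x), (Finset.range (M x)).filter fun n => ∃ h : n ∈ E, N ⟨n, h⟩ ∈ A x)) ?_
      (to_countable _))
    intro x hx y hy hxy
    by_contra hne
    simp only [Prod.mk.injEq] at hxy
    obtain ⟨h1, h2, h3⟩ := hxy
    rw [h1] at h2 h3
    obtain ⟨n, hn, hn'⟩ := hM y hy x hx hne fun k hk => PiNat.res_eq_res.1 h2 hk
    have := Finset.ext_iff.1 h3 n
    simp only [Finset.mem_filter, Finset.mem_range, hn, true_and, Subtype.coe_prop,
      exists_true_left, Subtype.coe_eta] at this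
    tauto
  choose y hyL hyx hyc hyA using hx
  choose d hd using fun M => Function.ne_iff.1 (hc.ne (hyx M))
  have hMd : ∀ M, M ≤ d M := fun M => by
    by_contra! h
    exact hd M (hyc M _ h)
  let M : ℕ → ℕ := fun i => Nat.rec 0 (fun _ k => d k + 1) i
  have hMs : ∀ i, M (i + 1) = d (M i) + 1 := fun i => rfl
  have hMmono : Monotone M := monotone_nat_of_le_succ fun i => by
    rw [hMs]
    exact (hMd _).trans (Nat.le_succ _)
  have hlt : ∀ i j, i < j → d (M i) < M j := fun i j hij =>
    (Nat.lt_succ_self _).trans_le ((hMs i).symm.le.trans (hMmono hij))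
  have hAA : ∀ i j, i < j → A (y (M i)) ∩ A (y (M j)) ⊆ A x := by
    rintro i j hij p ⟨hpi, hpj⟩
    have hne : c (y (M i)) (d (M i)) ≠ c (y (M j)) (d (M i)) := by
      rw [hyc (M j) _ (hlt i j hij)]
      exact hd _
    obtain ⟨n, rfl, hn⟩ := hUU _ _ _ hne p ⟨hAU _ hpi, hAU _ hpj⟩
    exact (hyA (M j) n (hn.trans_lt (hlt i j hij))).1 hpj
  obtain ⟨𝓑, h𝓑, hfin, h1, h2⟩ := happrox (U x)ᶜ (A x)ᶜ (hU x).isClosed_compl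
    (h𝒞 _ (hA𝒞 x)).isOpen_compl (compl_subset_compl.2 (hAU x))
  have hB : ∀ i, ∃ B : 𝓑, (A (y (M i)) ∩ B).Nonempty := by
    intro i
    obtain ⟨n, hn, hnx⟩ := (hAinf (y (M i))).exists_notMem_finite (hbdd (d (M i)))
    obtain ⟨B, hB, hnB⟩ := h1 (show N n ∈ (U x)ᶜ from fun h =>
      hnx (hle _ _ _ (hd (M i)) n (hAU _ hn) h))
    exact ⟨⟨B, hB⟩, N n, hn, hnB⟩
  choose B hB using hB
  have := hfin.to_subtype
  obtain ⟨i, j, hij, hBij⟩ : ∃ i j, i < j ∧ B i = B j := by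
    obtain ⟨i, j, hne, h⟩ := Finite.exists_ne_map_eq_of_infinite B
    rcases lt_or_gt_of_ne hne with h' | h'
    · exact ⟨i, j, h', h⟩
    · exact ⟨j, i, h', h.symm⟩
  obtain ⟨p, hp, hpB⟩ := hHelly _ (hA𝒞 (y (M i))) _ (hA𝒞 (y (M j))) _ (h𝓑 (B i).2)
    ⟨N n₀, hL _ (hyL _), hL _ (hyL _)⟩ (hB i) (hBij ▸ hB j)
  exact h2 ⟨_, (B i).2, hpB⟩ (hAA i j hij hp)

theorem DenseRange.infinite_preimage {X : Type*} [TopologicalSpace X] [T1Space X] {ι : Type*}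
    {N : ι → X} (hN : DenseRange N) {x : X} (hx : ¬ IsOpen {x}) {O : Set X} (hO : IsOpen O)
    (hxO : x ∈ O) : (N ⁻¹' O).Infinite := by
  intro hfin
  have hsub : O ⊆ N '' (N ⁻¹' O) := by
    intro p hp
    by_contra hpN
    obtain ⟨_, ⟨h1, h2⟩, n, rfl⟩ := hN.inter_open_nonempty (O ∩ (N '' (N ⁻¹' O))ᶜ)
      (hO.inter (hfin.image N).isClosed.isOpen_compl) ⟨p, hp, hpN⟩
    exact h2 ⟨n, h1, rfl⟩
  have hOfin : O.Finite := (hfin.image N).subset hsub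
  refine hx ?_
  have : {x} = O ∩ (O \ {x})ᶜ := by
    ext p
    simp only [mem_singleton_iff, mem_inter_iff, mem_compl_iff, mem_sdiff, not_and, not_not]
    exact ⟨fun h => ⟨h.symm ▸ hxO, fun _ => h⟩, fun h => h.2 h.1⟩
  rw [this]
  exact hO.inter (hOfin.subset sdiff_subset).isClosed.isOpen_compl

theorem IsHereditarilySupercompact.compactSpace {X : Type*} [TopologicalSpace X]
    (hX : IsHereditarilySupercompact X) : CompactSpace X := by
  have := (hX univ isClosed_univ).compactSpace
  exact isCompact_univ_iff.1 (isCompact_iff_compactSpace.2 this)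

theorem IsHereditarilySupercompact.false_of_uncountable_discrete_of_not_isOpen (hMA : MartinsAxiom)
    {X : Type*} [TopologicalSpace X] [T2Space X] [SeparableSpace X]
    (hX : IsHereditarilySupercompact X) {J : Type} [Uncountable J]
    (hcard : Cardinal.mk J < Cardinal.continuum) (x : J → X) (V : J → Set X)
    (hV : ∀ α, IsOpen (V α)) (hxV : ∀ α, x α ∈ V α) (hsep : ∀ α β, α ≠ β → x α ∉ V β)
    (hiso : ∀ α, ¬ IsOpen {x α}) : False := by
  have := hX.compactSpace
  have hJ : Nonempty J := inferInstance
  have : Nonempty X := hJ.map x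
  let N : ℕ → X := denseSeq X
  have hN : DenseRange N := denseRange_denseSeq X
  choose Q hQn hQ hQV using fun α => exists_mem_nhds_isClosed_subset ((hV α).mem_nhds (hxV α))
  choose R hRn hR hRQ using fun α => exists_mem_nhds_isClosed_subset
    (isOpen_interior.mem_nhds (mem_interior_iff_mem_nhds.2 (hQn α)))
  obtain ⟨⟨c, hc⟩⟩ : Nonempty (J ↪ (ℕ → Bool)) :=
    Cardinal.lift_mk_le'.1 (by simpa using hcard.le)
  obtain ⟨E, t, hE, ht⟩ := hMA.exists_uniformization hcard (fun α => N ⁻¹' interior (R α))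
    (fun α => N ⁻¹' interior (Q α)) (fun α H hα => by
      refine (hN.infinite_preimage (hiso α) (O := interior (R α) ∩ (⋃ β ∈ H, Q β)ᶜ)
        (isOpen_interior.inter (isClosed_biUnion_finset fun β _ => hQ β).isOpen_compl)
        ⟨mem_interior_iff_mem_nhds.2 (hRn α), ?_⟩).mono ?_
      · simp only [mem_compl_iff, mem_iUnion, not_exists]
        rintro β hβ h
        exact hsep α β (fun h => hα (h ▸ hβ)) (hQV β h)
      · rintro n ⟨h1, h2⟩
        refine ⟨h1, fun h => h2 ?_⟩
        obtain ⟨β, hβ, h⟩ := mem_iUnion₂.1 h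
        exact mem_biUnion hβ (interior_subset h))
    (fun α n => PiNat.res (c α) n)
  choose k hk using ht
  obtain ⟨k₀, hk₀⟩ := exists_not_countable_preimage k
  have : Uncountable (k ⁻¹' {k₀}) := not_countable_iff.1 hk₀
  let E' : Set ℕ := {n ∈ E | k₀ ≤ n}
  let N' : E' → closure (N '' E') := fun n => ⟨N n, subset_closure ⟨n, n.2, rfl⟩⟩
  refine (hX (closure (N '' E')) isClosed_closure).false_of_branches N' ?_
    (fun α : k ⁻¹' {k₀} => c α) (hc.comp Subtype.val_injective) (fun n => t ⟨n, n.2.1⟩)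
    (fun α => Subtype.val ⁻¹' interior (Q α)) (fun α => Subtype.val ⁻¹' R α)
    (fun α => isOpen_interior.preimage continuous_subtype_val)
    (fun α => (hR α).preimage continuous_subtype_val)
    (fun α => preimage_mono (hRQ α)) ?_ ?_
  · refine Subtype.dense_iff.2 (closure_mono ?_)
    rintro _ ⟨n, hn, rfl⟩
    exact ⟨_, ⟨⟨n, hn⟩, rfl⟩, rfl⟩
  · intro α hfin
    refine hE α (((hfin.image Subtype.val).union (finite_Iio k₀)).subset ?_)
    rintro n ⟨hnE, hn⟩
    by_cases h : k₀ ≤ n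
    · have hnR : N n ∈ R α := interior_subset (mem_preimage.1 hn)
      exact Or.inl ⟨⟨n, hnE, h⟩, hnR, rfl⟩
    · exact Or.inr (not_le.1 h)
  · rintro ⟨α, hα⟩ ⟨n, hn⟩ h
    exact hk α ⟨n, hn.1⟩ ((hα : k α = k₀).le.trans hn.2) h

/-- Under Martin's Axiom, discrete subspaces of separable hereditarily supercompact spaces cannot
have uncountable size below the continuum. -/
theorem IsHereditarilySupercompact.false_of_uncountable_discrete (hMA : MartinsAxiom)
    {X : Type*} [TopologicalSpace X] [T2Space X] [SeparableSpace X]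
    (hX : IsHereditarilySupercompact X) {J : Type} [Uncountable J]
    (hcard : Cardinal.mk J < Cardinal.continuum) (x : J → X) (V : J → Set X)
    (hV : ∀ α, IsOpen (V α)) (hxV : ∀ α, x α ∈ V α) (hsep : ∀ α β, α ≠ β → x α ∉ V β) :
    False := by
  obtain ⟨s, hs, hsd⟩ := exists_countable_dense X
  have hinj : Function.Injective x := fun α β h => by
    by_contra hne
    exact hsep α β hne (h ▸ hxV β)
  have hc : {α | IsOpen {x α}}.Countable := by
    refine countable_of_injective_of_countable_image hinj.injOn (hs.mono ?_)
    rintro _ ⟨α, hα, rfl⟩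
    obtain ⟨p, hp, hps⟩ := hsd.inter_open_nonempty _ hα (singleton_nonempty _)
    exact (mem_singleton_iff.1 hp) ▸ hps
  have : Uncountable ({α | IsOpen {x α}}ᶜ : Set J) := by
    refine not_countable_iff.1 fun h => not_countable_univ (α := J) ?_
    rw [← union_compl_self {α | IsOpen {x α}}]
    exact hc.union h
  exact hX.false_of_uncountable_discrete_of_not_isOpen hMA
    ((Cardinal.mk_set_le _).trans_lt hcard) (fun α : ({α | IsOpen {x α}}ᶜ : Set J) => x α)
    (fun α => V α) (fun α => hV α) (fun α => hxV α)
    (fun α β h => hsep α β (Subtype.coe_ne_coe.2 h)) (fun α => α.2)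

/-- Under MA + ¬CH, every separable hereditarily supercompact Hausdorff space is
hereditarily separable and hereditarily Lindelöf. -/
theorem hereditarilySeparable_and_hereditarilyLindelof_of_separable_hereditarilySupercompact
    (hMA : MartinsAxiom) (hCH : Cardinal.aleph 1 < Cardinal.continuum)
    (X : Type u) [TopologicalSpace X] [T2Space X] [TopologicalSpace.SeparableSpace X]
    (hX : IsHereditarilySupercompact X) :
    (∀ A : Set X, TopologicalSpace.SeparableSpace A) ∧
      (∀ A : Set X, LindelofSpace A) := by
  have hCH' : Cardinal.aleph.{0} 1 < Cardinal.continuum.{0} := by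
    have h := Cardinal.lift_lt.{_, 0}.2 hCH
    rw [← Cardinal.lift_lt]
    simpa only [Cardinal.lift_aleph, Cardinal.lift_continuum, Ordinal.lift_one] using h
  let I : Type := (Cardinal.aleph.{0} 1).ord.ToType
  have hIcard : Cardinal.mk I = Cardinal.aleph 1 := Cardinal.mk_ord_toType _
  have hcard : Cardinal.mk I < Cardinal.continuum := hIcard.trans_lt hCH'
  have hI : ∀ i : I, (Iio i).Countable := fun i => by
    have h := Cardinal.mk_Iio_lt i (by simp [I])
    rw [hIcard] at h
    exact Cardinal.le_aleph0_iff_set_countable.1 (Cardinal.lt_aleph_one_iff.1 h)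
  have hIunc : Uncountable I := by
    rw [← Cardinal.aleph0_lt_mk_iff, hIcard, ← Cardinal.aleph_zero]
    exact Cardinal.aleph_lt_aleph.2 zero_lt_one
  have := hX.compactSpace
  have htight : IsCountablyTight X := .of_countable_discrete hI fun x V hV hxV hsep =>
    hX.false_of_uncountable_discrete hMA hcard x V hV hxV hsep
  have hfalse : ∀ (x : I → X) (W : I → Set X), (∀ i, IsOpen (W i)) → (∀ i, x i ∈ W i) →
      (∀ i j, i < j → x j ∉ W i) ∨ (∀ i j, i < j → x i ∉ W j) → False := by
    intro x W hW hxW hsep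
    obtain ⟨D, V, hD, hV, hxV, hDV⟩ :=
      hMA.exists_uncountable_discrete hI hcard htight x W hW hxW hsep
    have : Uncountable D := not_countable_iff.1 hD
    exact hX.false_of_uncountable_discrete hMA ((Cardinal.mk_set_le D).trans_lt hcard)
      (fun i : D => x i) (fun i => V i) (fun i => hV i) (fun i => hxV i)
      fun i j hij => hDV i i.2 j j.2 (Subtype.coe_ne_coe.2 hij)
  refine ⟨fun A => ?_, fun A => ?_⟩
  · by_contra hA
    obtain ⟨f, hf⟩ := exists_forall_image_Iio hI
      (fun (C : Set A) x => (x : X) ∉ closure (Subtype.val '' C)) (by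
        intro C hC
        by_contra! h
        exact hA ⟨C, hC, Subtype.dense_iff.2 fun x hx => h ⟨x, hx⟩⟩)
    refine hfalse (fun i => f i) (fun i => (closure (Subtype.val '' (f '' Iio i)))ᶜ)
      (fun i => isClosed_closure.isOpen_compl) hf (Or.inr fun i j hij h => h ?_)
    exact subset_closure ⟨f i, ⟨i, hij, rfl⟩, rfl⟩
  · rw [← isLindelof_iff_lindelofSpace]
    refine isLindelof_of_countable_subcover fun {ι} U hU hAU => ?_
    by_contra! hcon
    obtain ⟨f, hf⟩ := exists_forall_image_Iio hI
      (fun (C : Set (X × ι)) p => p.1 ∈ U p.2 ∧ ∀ q ∈ C, p.1 ∉ U q.2) (by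
        intro C hC
        obtain ⟨x, hxA, hx⟩ := not_subset.1 (hcon (Prod.snd '' C) (hC.image _))
        obtain ⟨i, hi⟩ := mem_iUnion.1 (hAU hxA)
        exact ⟨(x, i), hi, fun q hq h => hx (mem_biUnion (mem_image_of_mem _ hq) h)⟩)
    exact hfalse (fun i => (f i).1) (fun i => U (f i).2) (fun i => hU _) (fun i => (hf i).1)
      (Or.inl fun i j hij => (hf j).2 (f i) ⟨i, hij, rfl⟩)
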